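/- Let {B_k}_{k=0}^{d-1} be a Fourier family on ℂ^n, set S(α) = ∑_{k=1}^{d-1} ( γ(α)·X_d^k ⊗ B_k + δ_k(α)·Z_d^k ⊗ 𝟙_n ), and let ψ ∈ ℂ^d ⊗ ℂ^n ⊗ ℂ^m be a unit vector whose reduced density matrix ρ_B on the middle factor is invertible. If (S(α) ⊗ 𝟙_m) ψ = ψ, then every B_k (k = 1,…,d−1) is unitary: B_k†B_k = 𝟙_n. -/

import Mathlib

open Matrix Kronecker Finset
open scoped ComplexOrder

noncomputable section

/-- `ω = exp(2πi/d)`. -/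
def om (d : ℕ) : ℂ := Complex.exp (2 * Real.pi * Complex.I / d)

/-- The generalized Pauli matrix `Z_d = ∑_i ω^i |i⟩⟨i|`. -/
def Zd (d : ℕ) : Matrix (Fin d) (Fin d) ℂ :=
  Matrix.diagonal fun i => om d ^ (i : ℕ)

/-- The generalized Pauli matrix `X_d = ∑_i |i+1 mod d⟩⟨i|`. -/
def Xd (d : ℕ) : Matrix (Fin d) (Fin d) ℂ :=
  Matrix.of fun i j => if (i : ℕ) = ((j : ℕ) + 1) % d then 1 else 0

/-- `γ(α) = d / ∑_{i≠j} α_i/α_j` (sum over ordered pairs `i ≠ j`). -/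
def gam (d : ℕ) (α : Fin d → ℝ) : ℝ :=
  d / ∑ i : Fin d, ∑ j : Fin d, if i ≠ j then α i / α j else 0

/-- `δ_k(α) = -(γ(α)/d) ∑_{i≠j} (α_i/α_j) ω^{k(d-j)}`. -/
def delt (d : ℕ) (α : Fin d → ℝ) (k : ℕ) : ℂ :=
  -(((gam d α : ℝ) : ℂ) / d) * ∑ i : Fin d, ∑ j : Fin d,
    if i ≠ j then ((α i / α j : ℝ) : ℂ) * om d ^ (k * (d - (j : ℕ))) else 0

/-- A Fourier family on `ℂ^n`: `B 0 = 1`, `Bₖ†Bₖ ≤ 𝟙`, and `B_{d-k} = Bₖ†` (the latter stated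
via negation in `Fin d`). -/
def IsFourierFamily (d n : ℕ) (B : Fin d → Matrix (Fin n) (Fin n) ℂ) : Prop :=
  (∀ k : Fin d, (k : ℕ) = 0 → B k = 1) ∧
  (∀ k : Fin d, ((1 : Matrix (Fin n) (Fin n) ℂ) - (B k)ᴴ * B k).PosSemidef) ∧
  (∀ k : Fin d, B (-k) = (B k)ᴴ)

/-- The operator `S(α) = ∑_{k=1}^{d-1} (γ(α)·X_d^k ⊗ B_k + δ_k(α)·Z_d^k ⊗ 𝟙_n)`. -/
def sOp (d n : ℕ) (α : Fin d → ℝ) (B : Fin d → Matrix (Fin n) (Fin n) ℂ) :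
    Matrix (Fin d × Fin n) (Fin d × Fin n) ℂ :=
  ∑ k ∈ Finset.univ.filter (fun k : Fin d => (k : ℕ) ≠ 0),
    (((gam d α : ℝ) : ℂ) • ((Xd d ^ (k : ℕ)) ⊗ₖ B k)
      + delt d α (k : ℕ) • ((Zd d ^ (k : ℕ)) ⊗ₖ (1 : Matrix (Fin n) (Fin n) ℂ)))

/-- The reduced density matrix on the middle factor of a vector `ψ ∈ ℂ^d ⊗ ℂ^n ⊗ ℂ^m`:
`ρ_B[b,b'] = ∑_{a,e} ψ_{a,b,e}·conj(ψ_{a,b',e})`. -/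
def rhoB (d n m : ℕ) (ψ : (Fin d × Fin n) × Fin m → ℂ) : Matrix (Fin n) (Fin n) ℂ :=
  Matrix.of fun b b' => ∑ a : Fin d, ∑ e : Fin m, ψ ((a, b), e) * (starRingEnd ℂ) (ψ ((a, b'), e))


lemma Xd_pow_apply (d : ℕ) [NeZero d] (k : ℕ) (i j : Fin d) :
    (Xd d ^ k) i j = if (i : ℕ) = ((j : ℕ) + k) % d then 1 else 0 := by
  induction k generalizing i j with
  | zero =>
    simp [Matrix.one_apply, Nat.mod_eq_of_lt j.2, Fin.ext_iff]
  | succ k ih =>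
    have hd : 0 < d := Nat.pos_of_ne_zero (NeZero.ne d)
    rw [pow_succ, Matrix.mul_apply, Finset.sum_eq_single (⟨((j : ℕ) + 1) % d, Nat.mod_lt _ hd⟩ : Fin d)]
    · rw [ih]
      simp only [Xd, Matrix.of_apply, if_true, mul_one, Nat.mod_add_mod]
      rw [show (j : ℕ) + 1 + k = j + (k + 1) by ring]
    · intro l _ hl
      have : ¬ (l : ℕ) = ((j : ℕ) + 1) % d := fun h => hl (Fin.ext h)
      simp [Xd, this]
    · simp

lemma Xd_pow_apply' (d : ℕ) [NeZero d] (k : Fin d) (i j : Fin d) :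
    (Xd d ^ (k : ℕ)) i j = if i = j + k then 1 else 0 := by
  rw [Xd_pow_apply]
  simp [Fin.ext_iff, Fin.val_add]

lemma om_prim (d : ℕ) [NeZero d] : IsPrimitiveRoot (om d) d :=
  Complex.isPrimitiveRoot_exp d (NeZero.ne d)

lemma fsum (d : ℕ) [NeZero d] (a j : Fin d) :
    ∑ k ∈ Finset.univ.filter (fun k : Fin d => (k : ℕ) ≠ 0),
      om d ^ ((k : ℕ) * (d - (j : ℕ))) * om d ^ ((a : ℕ) * (k : ℕ))
      = (if a = j then (d : ℂ) else 0) - 1 := by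
  set z : ℂ := om d ^ (d - (j : ℕ) + a) with hz
  have h1 : ∀ k : Fin d, om d ^ ((k : ℕ) * (d - (j : ℕ))) * om d ^ ((a : ℕ) * (k : ℕ)) = z ^ (k : ℕ) := by
    intro k
    rw [hz, ← pow_mul, ← pow_add]; congr 1; ring
  simp_rw [h1]
  have h2 : ∑ k : Fin d, z ^ (k : ℕ) = if a = j then (d : ℂ) else 0 := by
    rw [Fin.sum_univ_eq_sum_range (fun k => z ^ k) d]
    have hj := j.2
    have ha := a.2
    split_ifs with h
    · have : z = 1 := by
        rw [hz, h, Nat.sub_add_cancel hj.le]; exact (om_prim d).pow_eq_one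
      simp [this]
    · have hne : z ≠ 1 := by
        intro h1
        rw [hz, (om_prim d).pow_eq_one_iff_dvd] at h1
        apply h
        obtain ⟨c, hc⟩ := h1
        have : c = 1 := by
          rcases c with _ | _ | c
          · omega
          · rfl
          · exfalso
            have : d * (c + 1 + 1) = d * c + 2 * d := by ring
            have := Nat.zero_le (d * c)
            omega
        subst this
        ext; omega
      have hzd : z ^ d = 1 := by
        rw [hz, ← pow_mul, mul_comm, pow_mul, (om_prim d).pow_eq_one, one_pow]
      have := mul_geom_sum z d
      rw [hzd, sub_self] at this
      exact (mul_eq_zero.mp this).resolve_left (sub_ne_zero.mpr hne)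
  rw [← h2, ← Finset.sum_filter_add_sum_filter_not Finset.univ (fun k : Fin d => (k : ℕ) ≠ 0)]
  have : Finset.univ.filter (fun k : Fin d => ¬ (k : ℕ) ≠ 0) = {0} := by
    ext k; simp only [Finset.mem_filter, Finset.mem_univ, true_and, not_not, Finset.mem_singleton, Fin.val_eq_zero_iff]
  rw [this]; simp

lemma tot_pos (d : ℕ) (hd : 2 ≤ d) (α : Fin d → ℝ) (hpos : ∀ i, 0 < α i) :
    0 < ∑ i : Fin d, ∑ j : Fin d, if i ≠ j then α i / α j else 0 := by
  have hnn : ∀ i j : Fin d, 0 ≤ if i ≠ j then α i / α j else 0 := by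
    intro i j; split_ifs
    · exact (div_pos (hpos i) (hpos j)).le
    · exact le_rfl
  refine Finset.sum_pos' (fun i _ => Finset.sum_nonneg fun j _ => hnn i j)
    ⟨⟨0, by omega⟩, Finset.mem_univ _, ?_⟩
  refine Finset.sum_pos' (fun j _ => hnn _ j) ⟨⟨1, by omega⟩, Finset.mem_univ _, ?_⟩
  simp only [ne_eq, Fin.mk.injEq, zero_ne_one, not_false_eq_true, if_true]
  exact div_pos (hpos _) (hpos _)

lemma dsum (d : ℕ) [NeZero d] (hd : 2 ≤ d) (α : Fin d → ℝ) (hpos : ∀ i, 0 < α i) (a : Fin d) :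
    ∑ k ∈ Finset.univ.filter (fun k : Fin d => (k : ℕ) ≠ 0),
      delt d α k * om d ^ ((a : ℕ) * (k : ℕ))
      = 1 - (gam d α : ℂ) * ∑ i : Fin d, if i ≠ a then ((α i / α a : ℝ) : ℂ) else 0 := by
  have hT := tot_pos d hd α hpos
  set T := ∑ i : Fin d, ∑ j : Fin d, if i ≠ j then α i / α j else 0 with hTd
  have hd0 : (d : ℂ) ≠ 0 := by exact_mod_cast NeZero.ne d
  have hg : (gam d α : ℂ) = d / (T : ℂ) := by
    simp only [gam, ← hTd]; push_cast; rfl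
  have hTc : (T : ℂ) ≠ 0 := by exact_mod_cast hT.ne'
  have e1 : ∑ k ∈ Finset.univ.filter (fun k : Fin d => (k : ℕ) ≠ 0),
      delt d α k * om d ^ ((a : ℕ) * (k : ℕ)) = -((gam d α : ℂ) / d) *
      ∑ i : Fin d, ∑ j : Fin d, (if i ≠ j then ((α i / α j : ℝ) : ℂ) else 0) *
        ((if a = j then (d : ℂ) else 0) - 1) := by
    simp only [delt, mul_assoc, ← Finset.mul_sum, Finset.sum_mul]
    congr 1
    rw [Finset.sum_comm]
    refine Finset.sum_congr rfl fun i _ => ?_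
    rw [Finset.sum_comm]
    refine Finset.sum_congr rfl fun j _ => ?_
    rw [← fsum, Finset.mul_sum]
    refine Finset.sum_congr rfl fun k _ => ?_
    split_ifs <;> ring
  have hTT : (T : ℂ) = ∑ i : Fin d, ∑ j : Fin d, if i ≠ j then ((α i / α j : ℝ) : ℂ) else 0 := by
    rw [hTd]; push_cast
    refine Finset.sum_congr rfl fun i _ => Finset.sum_congr rfl fun j _ => ?_
    split_ifs <;> simp
  have e2 : ∑ i : Fin d, ∑ j : Fin d, (if i ≠ j then ((α i / α j : ℝ) : ℂ) else 0) *
        ((if a = j then (d : ℂ) else 0) - 1)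
      = d * (∑ i : Fin d, if i ≠ a then ((α i / α a : ℝ) : ℂ) else 0) - T := by
    rw [hTT]
    simp_rw [mul_sub, mul_one, Finset.sum_sub_distrib, mul_ite, mul_zero, Finset.sum_ite_eq,
      Finset.mem_univ, if_true]
    rw [Finset.mul_sum]
    congr 1
    refine Finset.sum_congr rfl fun i _ => ?_
    split_ifs <;> ring
  rw [e1, e2, hg]
  field_simp
  ring

/-- slice of the vector as matrix -/
def slc {d n m : ℕ} (ψ : (Fin d × Fin n) × Fin m → ℂ) (a : Fin d) : Matrix (Fin n) (Fin m) ℂ :=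
  Matrix.of fun b e => ψ ((a, b), e)

lemma sOp_apply (d n : ℕ) [NeZero d] (hd : 2 ≤ d) (α : Fin d → ℝ) (hpos : ∀ i, 0 < α i)
    (B : Fin d → Matrix (Fin n) (Fin n) ℂ) (a a' : Fin d) (b b' : Fin n) :
    sOp d n α B (a, b) (a', b') =
      (gam d α : ℂ) * (if a ≠ a' then B (a - a') b b' else 0) +
      (if a = a' then (1 - (gam d α : ℂ) * ∑ i : Fin d, if i ≠ a then ((α i / α a : ℝ) : ℂ) else 0)
        * (1 : Matrix (Fin n) (Fin n) ℂ) b b' else 0) := by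
  rw [← dsum d hd α hpos a, sOp, Matrix.sum_apply]
  simp only [Matrix.add_apply, Matrix.smul_apply, Matrix.kroneckerMap_apply, smul_eq_mul]
  rw [Finset.sum_add_distrib]
  congr 1
  · rw [← Finset.mul_sum]
    congr 1
    simp_rw [Xd_pow_apply', Finset.sum_filter]
    rw [Finset.sum_eq_single (a - a')]
    · simp only [add_sub_cancel, if_true, one_mul]
      have : ((a - a' : Fin d) : ℕ) ≠ 0 ↔ a ≠ a' := by
        rw [Fin.val_ne_zero_iff, sub_ne_zero]
      simp only [this]
    · intro k _ hk
      have : ¬ a = a' + k := fun h => hk (by rw [h]; simp)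
      simp [this]
    · simp
  · split_ifs with h
    · subst h
      rw [Finset.sum_mul]
      refine Finset.sum_congr rfl fun k _ => ?_
      simp only [Zd, Matrix.diagonal_pow, Matrix.diagonal_apply_eq, Pi.pow_apply, ← pow_mul]
      ring
    · refine Finset.sum_eq_zero fun k _ => ?_
      simp [Zd, Matrix.diagonal_pow, h]

lemma key (d n m : ℕ) [NeZero d] (hd : 2 ≤ d)
    (α : Fin d → ℝ) (hpos : ∀ i, 0 < α i)
    (B : Fin d → Matrix (Fin n) (Fin n) ℂ)
    (ψ : (Fin d × Fin n) × Fin m → ℂ)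
    (hfix : ((sOp d n α B) ⊗ₖ (1 : Matrix (Fin m) (Fin m) ℂ)).mulVec ψ = ψ) (a : Fin d) :
    ∑ i : Fin d, (if a ≠ i then B (a - i) * slc ψ i else 0) =
      ∑ i : Fin d, (if a ≠ i then ((α i / α a : ℝ) : ℂ) • slc ψ a else 0) := by
  have hg : (gam d α : ℂ) ≠ 0 := by
    have hT := tot_pos d hd α hpos
    have : gam d α ≠ 0 := by
      unfold gam
      exact div_ne_zero (by exact_mod_cast NeZero.ne d) hT.ne'
    exact_mod_cast this
  ext b e
  have h := congrFun hfix ((a, b), e)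
  simp only [Matrix.mulVec, dotProduct, Fintype.sum_prod_type, Matrix.kroneckerMap_apply,
    sOp_apply d n hd α hpos] at h
  simp only [Matrix.one_apply, mul_ite, mul_one, mul_zero, ite_mul, zero_mul, Finset.sum_ite_eq,
    Finset.mem_univ, if_true, add_mul, Finset.sum_add_distrib] at h
  simp only [Matrix.sum_apply]
  have hL : ∀ i : Fin d, (if a ≠ i then B (a - i) * slc ψ i else 0) b e =
      ∑ b', if a ≠ i then B (a - i) b b' * ψ ((i, b'), e) else 0 := by
    intro i
    split_ifs <;> simp [Matrix.mul_apply, slc]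
  have hR : ∀ i : Fin d, (if a ≠ i then ((α i / α a : ℝ) : ℂ) • slc ψ a else 0) b e =
      (if i ≠ a then ((α i / α a : ℝ) : ℂ) else 0) * ψ ((a, b), e) := by
    intro i
    by_cases hi : a = i
    · subst hi; simp
    · simp [hi, Ne.symm hi, slc]
  simp_rw [hL, hR, ← Finset.sum_mul]
  apply mul_left_cancel₀ hg
  have hA : (gam d α : ℂ) * ∑ i : Fin d, ∑ b', (if a ≠ i then B (a - i) b b' * ψ ((i, b'), e) else 0)
     = ∑ i : Fin d, ∑ b', if a ≠ i then (gam d α : ℂ) * B (a - i) b b' * ψ ((i, b'), e) else 0 := by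
    simp_rw [Finset.mul_sum]
    refine Finset.sum_congr rfl fun i _ => Finset.sum_congr rfl fun j _ => ?_
    split_ifs <;> ring
  rw [hA]
  have hS : ∀ x : ℂ, (∑ i : Fin d, ∑ b' : Fin n, if a = i then if b = b' then
     x * ψ ((i, b'), e) else 0 else 0) = x * ψ ((a, b), e) := by
    intro x
    rw [Finset.sum_eq_single a]
    · simp
    · intro i _ hi; simp [Ne.symm hi]
    · simp
  rw [hS] at h
  linear_combination h

/-- Hilbert-Schmidt pairing -/
def hs {n m : ℕ} (A C : Matrix (Fin n) (Fin m) ℂ) : ℂ := (Aᴴ * C).trace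

lemma hs_nonneg {n m : ℕ} (A : Matrix (Fin n) (Fin m) ℂ) : 0 ≤ (hs A A).re :=
  (Complex.le_def.mp (Matrix.posSemidef_conjTranspose_mul_self A).trace_nonneg).1

lemma hs_zero {n m : ℕ} (A : Matrix (Fin n) (Fin m) ℂ) (h : (hs A A).re = 0) : A = 0 := by
  have h2 := (Matrix.posSemidef_conjTranspose_mul_self A).trace_nonneg
  rw [← Matrix.trace_conjTranspose_mul_self_eq_zero_iff]
  apply Complex.ext
  · exact h
  · exact (Complex.le_def.mp h2).2.symm

lemma hs_contr {n m : ℕ} (C : Matrix (Fin n) (Fin n) ℂ) (hC : (1 - Cᴴ * C).PosSemidef)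
    (A : Matrix (Fin n) (Fin m) ℂ) : (hs (C * A) (C * A)).re ≤ (hs A A).re := by
  have h := (Complex.le_def.mp (hC.conjTranspose_mul_mul_same A).trace_nonneg).1
  have e : Aᴴ * (1 - Cᴴ * C) * A = Aᴴ * A - (C * A)ᴴ * (C * A) := by
    rw [Matrix.conjTranspose_mul]
    simp only [Matrix.mul_sub, Matrix.sub_mul, Matrix.mul_one, Matrix.mul_assoc]
  rw [e, Matrix.trace_sub, Complex.sub_re] at h
  simp only [Complex.zero_re] at h
  unfold hs; linarith

lemma hs_expand {n m : ℕ} (A C : Matrix (Fin n) (Fin m) ℂ) (t : ℝ) :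
    (hs (A - (t : ℂ) • C) (A - (t : ℂ) • C)).re
      = (hs A A).re - 2 * t * (hs A C).re + t ^ 2 * (hs C C).re := by
  have hc : (hs C A).re = (hs A C).re := by
    unfold hs
    rw [← Matrix.conjTranspose_conjTranspose A, ← Matrix.conjTranspose_mul,
      Matrix.trace_conjTranspose, Matrix.conjTranspose_conjTranspose]
    simp
  have : hs (A - (t : ℂ) • C) (A - (t : ℂ) • C) = hs A A - t * hs A C - t * hs C A + t * t * hs C C := by
    unfold hs
    simp [Matrix.mul_sub, Matrix.sub_mul, Matrix.trace_sub, Matrix.conjTranspose_smul]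
    ring
  rw [this]
  simp [hc]
  ring

lemma hs_sum {n m d : ℕ} (A : Matrix (Fin n) (Fin m) ℂ) (f : Fin d → Matrix (Fin n) (Fin m) ℂ) :
    (hs A (∑ i, f i)).re = ∑ i, (hs A (f i)).re := by
  unfold hs
  rw [Matrix.mul_sum, Matrix.trace_sum, Complex.re_sum]

lemma slices (d n m : ℕ) [NeZero d]
    (α : Fin d → ℝ) (hpos : ∀ i, 0 < α i)
    (B : Fin d → Matrix (Fin n) (Fin n) ℂ)
    (hB : ∀ k : Fin d, ((1 : Matrix (Fin n) (Fin n) ℂ) - (B k)ᴴ * B k).PosSemidef)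
    (P : Fin d → Matrix (Fin n) (Fin m) ℂ)
    (h : ∀ a, ∑ i : Fin d, (if a ≠ i then B (a - i) * P i else 0) =
      ∑ i : Fin d, (if a ≠ i then ((α i / α a : ℝ) : ℂ) • P a else 0)) (a i : Fin d) (hai : a ≠ i) :
    P a = ((α a / α i : ℝ) : ℂ) • (B (a - i) * P i) := by
  have h1 : ∀ a, ∑ i : Fin d, (if a ≠ i then (hs (P a) (B (a - i) * P i)).re else 0) =
      ∑ i : Fin d, (if a ≠ i then (α i / α a) * (hs (P a) (P a)).re else 0) := by
    intro a
    have := congrArg (fun M => (hs (P a) M).re) (h a)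
    simp only [hs_sum] at this
    convert this using 1
    · refine Finset.sum_congr rfl fun i _ => ?_
      split_ifs <;> simp [hs]
    · refine Finset.sum_congr rfl fun i _ => ?_
      split_ifs
      · simp only [hs, Matrix.mul_smul, Matrix.trace_smul, smul_eq_mul, Complex.re_ofReal_mul]
      · simp [hs]
  set F : Fin d → Fin d → ℝ := fun a i => if a ≠ i then
    (α i / α a) * (hs (P a - ((α a / α i : ℝ) : ℂ) • (B (a - i) * P i))
      (P a - ((α a / α i : ℝ) : ℂ) • (B (a - i) * P i))).re else 0 with hF
  have hFnn : ∀ a i, 0 ≤ F a i := by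
    intro a i
    simp only [hF]; split_ifs
    · exact mul_nonneg (div_pos (hpos _) (hpos _)).le (hs_nonneg _)
    · exact le_rfl
  have hFle : ∀ a i, F a i ≤ (if a ≠ i then (α i / α a) * (hs (P a) (P a)).re else 0)
      - 2 * (if a ≠ i then (hs (P a) (B (a - i) * P i)).re else 0)
      + (if i ≠ a then (α a / α i) * (hs (P i) (P i)).re else 0) := by
    intro a i
    simp only [hF]
    by_cases hai : a = i
    · simp [hai]
    · simp only [ne_eq, hai, Ne.symm hai, not_false_eq_true, if_true]
      rw [hs_expand]
      have hc := mul_le_mul_of_nonneg_left (hs_contr _ (hB (a - i)) (P i))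
        (div_pos (hpos a) (hpos i)).le
      have ha := (hpos a).ne'
      have hi := (hpos i).ne'
      have : ∀ x y z : ℝ, α i / α a * (x - 2 * (α a / α i) * y + (α a / α i) ^ 2 * z)
        = α i / α a * x - 2 * y + α a / α i * z := by
        intro x y z; field_simp
      rw [this]
      linarith
  have hsum : ∑ a, ∑ i, F a i ≤ 0 := by
    refine (Finset.sum_le_sum fun a _ => Finset.sum_le_sum fun i _ => hFle a i).trans ?_
    simp only [Finset.sum_add_distrib, Finset.sum_sub_distrib, ← Finset.mul_sum, h1]
    rw [Finset.sum_comm (f := fun a i => if i ≠ a then (α a / α i) * (hs (P i) (P i)).re else 0)]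
    linarith
  have h0 : ∑ a, ∑ i, F a i = 0 :=
    le_antisymm hsum (Finset.sum_nonneg fun a _ => Finset.sum_nonneg fun i _ => hFnn a i)
  rw [Finset.sum_eq_zero_iff_of_nonneg
    (fun a _ => Finset.sum_nonneg fun i _ => hFnn a i)] at h0
  have h2 := h0 a (Finset.mem_univ _)
  rw [Finset.sum_eq_zero_iff_of_nonneg (fun i _ => hFnn a i)] at h2
  have h3 := h2 i (Finset.mem_univ _)
  simp only [hF, ne_eq, hai, not_false_eq_true, if_true] at h3
  have h4 := (mul_eq_zero.mp h3).resolve_left (div_pos (hpos _) (hpos _)).ne'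
  exact sub_eq_zero.mp (hs_zero _ h4)

/-- if a unit vector `ψ ∈ ℂ^d ⊗ ℂ^n ⊗ ℂ^m` with invertible reduced state `ρ_B`
satisfies `(S(α) ⊗ 𝟙_m) ψ = ψ`, then every `B_k` (k = 1,…,d−1) is unitary. -/
theorem sOp_fixed_point_implies_unitary (d n m : ℕ) [NeZero d] (hd : 2 ≤ d)
    (α : Fin d → ℝ) (hpos : ∀ i, 0 < α i) (hnorm : ∑ i, α i ^ 2 = 1)
    (B : Fin d → Matrix (Fin n) (Fin n) ℂ) (hB : IsFourierFamily d n B)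
    (ψ : (Fin d × Fin n) × Fin m → ℂ) (hψ : ∑ p, Complex.normSq (ψ p) = 1)
    (hrho : IsUnit (rhoB d n m ψ))
    (hfix : ((sOp d n α B) ⊗ₖ (1 : Matrix (Fin m) (Fin m) ℂ)).mulVec ψ = ψ) :
    ∀ k : Fin d, (k : ℕ) ≠ 0 → (B k)ᴴ * B k = 1 := by
  intro k hk
  have hP := slices d n m α hpos B hB.2.1 (slc ψ) (key d n m hd α hpos B ψ hfix)
  have hk0 : k ≠ 0 := fun h => hk (by simp [h])
  have hfixP : ∀ i, (B k)ᴴ * B k * slc ψ i = slc ψ i := by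
    intro i
    have hne : k + i ≠ i := by simpa using hk0
    have h1 := hP (k + i) i hne
    have h2 := hP i (k + i) hne.symm
    rw [add_sub_cancel_right] at h1
    rw [show i - (k + i) = -k by abel, hB.2.2 k, h1, Matrix.mul_smul, smul_smul] at h2
    have hc : ((α i / α (k + i) : ℝ) : ℂ) * ((α (k + i) / α i : ℝ) : ℂ) = 1 := by
      have ha := (hpos i).ne'
      have hi := (hpos (k + i)).ne'
      rw [← Complex.ofReal_mul]
      field_simp
      simp
    rw [hc, one_smul, ← Matrix.mul_assoc] at h2
    exact h2.symm
  have hr : rhoB d n m ψ = ∑ a, slc ψ a * (slc ψ a)ᴴ := by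
    ext b b'
    simp [rhoB, slc, Matrix.sum_apply, Matrix.mul_apply]
  have : (B k)ᴴ * B k * rhoB d n m ψ = 1 * rhoB d n m ψ := by
    rw [hr, Matrix.mul_sum, one_mul]
    refine Finset.sum_congr rfl fun a _ => ?_
    rw [← Matrix.mul_assoc, hfixP]
  exact hrho.mul_right_cancel this
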